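/- Let A be an irreducible k×k matrix with entries in {0,1}, let l_0,…,l_{k−1} be positive integers, and set L = l_0 + ⋯ + l_{k−1}. Define the discrete tower X = {(x, j) : x ∈ Σ_A, j ∈ ℤ, 0 ≤ j ≤ l_{x_0} − 1}, topologized as a subspace of Σ_A × {0,1,…,max_i l_i − 1}, with the homeomorphism T : X → X given by T(x, j) = (x, j+1) if j + 1 < l_{x_0}, and T(x, j) = (σx, 0) if j + 1 = l_{x_0}. Then there exists an irreducible L×L matrix B with entries in {0,1} such that the subshift of finite type (Σ_B, σ) is topologically conjugate to (X, T), i.e., there is a homeomorphism g : Σ_B → X with g ∘ σ = T ∘ g. -/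

import Mathlib

open MeasureTheory Real Filter Set

/-- The shift map on the full shift `ℤ → S`. -/
def shiftMap {S : Type*} : (ℤ → S) → (ℤ → S) := fun x i => x (i + 1)

/-- The subshift of finite type determined by the 0-1 matrix `A : S → S → ℕ`. -/
def SFT {S : Type*} (A : S → S → ℕ) : Set (ℤ → S) :=
  {x | ∀ i : ℤ, A (x i) (x (i + 1)) = 1}

/-- `w : Fin n → S` is an admissible word for the 0-1 matrix `A`. -/
def IsAdmissible {S : Type*} (A : S → S → ℕ) {n : ℕ} (w : Fin n → S) : Prop :=
  ∀ (i : ℕ) (h : i + 1 < n), A (w ⟨i, Nat.lt_of_succ_lt h⟩) (w ⟨i + 1, h⟩) = 1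

/-- The shift map restricted to the SFT determined by `A`. -/
def restrictShift {S : Type*} (A : S → S → ℕ) (x : ↥(SFT A)) : ↥(SFT A) :=
  ⟨shiftMap x.1, fun i => x.2 (i + 1)⟩

open Classical in
/-- The `n`-block recoding matrix `A_n`, indexed by admissible words of length `n`:
`(b,b')`-entry is 1 iff the last `n-1` letters of `b` coincide with the first `n-1`
letters of `b'`. -/
noncomputable def blockMatrix {S : Type*} (A : S → S → ℕ) (n : ℕ) :
    {w : Fin n → S // IsAdmissible A w} → {w : Fin n → S // IsAdmissible A w} → ℕ :=
  fun b b' =>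
    if ∀ (p : ℕ) (h : p + 1 < n), b.1 ⟨p + 1, h⟩ = b'.1 ⟨p, Nat.lt_of_succ_lt h⟩ then 1 else 0

open Classical in
/-- `m`-th power of the matrix `A : S → S → ℕ`. -/
noncomputable def matPow {S : Type*} [Fintype S] (A : S → S → ℕ) : ℕ → S → S → ℕ
  | 0 => fun i j => if i = j then 1 else 0
  | (m + 1) => fun i j => ∑ r : S, matPow A m i r * A r j

/-- A nonnegative matrix is irreducible if for every `(i,j)` some power has positive
`(i,j)`-entry. -/
def IrreducibleMat {S : Type*} [Fintype S] (A : S → S → ℕ) : Prop :=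
  ∀ i j : S, ∃ m : ℕ, 1 ≤ m ∧ 0 < matPow A m i j

noncomputable instance wordsFintype {S : Type*} [Fintype S] (A : S → S → ℕ) (n : ℕ) :
    Fintype {w : Fin n → S // IsAdmissible A w} := Fintype.ofFinite _

/-- Shannon entropy of the partition of the full shift into cylinders of length `n`
(based at coordinates `0, …, n-1`). -/
noncomputable def blockH {k : ℕ} (μ : Measure (ℤ → Fin k)) (n : ℕ) : ℝ :=
  ∑ w : Fin n → Fin k,
    Real.negMulLog (μ {x | ∀ p : Fin n, x ((p : ℕ) : ℤ) = w p}).toReal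

/-- The measure-theoretic (Kolmogorov–Sinai) entropy of a shift-invariant measure `μ`
on the full shift: since the coordinate partition is generating and `blockH μ` is
subadditive, it equals `inf_{n ≥ 1} blockH μ n / n`. -/
noncomputable def mEntropy {k : ℕ} (μ : Measure (ℤ → Fin k)) : ℝ :=
  ⨅ n : ℕ, blockH μ (n + 1) / (n + 1)

/-- The number of admissible words of length `n` for `A`. -/
noncomputable def wordCount {k : ℕ} (A : Fin k → Fin k → ℕ) (n : ℕ) : ℕ :=
  Nat.card {w : Fin n → Fin k // IsAdmissible A w}

/-- The topological entropy of the SFT determined by an irreducible matrix `A`: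
the exponential growth rate of the number of admissible words, which by
subadditivity equals `inf_{n ≥ 1} (log wordCount n) / n`. -/
noncomputable def topEnt {k : ℕ} (A : Fin k → Fin k → ℕ) : ℝ :=
  ⨅ n : ℕ, Real.log (wordCount A (n + 1)) / (n + 1)

/-- `μ` is a `σ`-invariant Borel probability measure carried by the SFT `Σ_A`. -/
def InvProbOn {k : ℕ} (A : Fin k → Fin k → ℕ) (μ : Measure (ℤ → Fin k)) : Prop :=
  IsProbabilityMeasure μ ∧ MeasurePreserving shiftMap μ μ ∧ μ (SFT A) = 1

/-- The discrete tower over the SFT `Σ_A` with integer heights `l i` over the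
cylinder `{x : x 0 = i}`, as a subspace of `Σ_A × ℕ` (with `ℕ` discrete). -/
def towerSet {k : ℕ} (A : Fin k → Fin k → ℕ) (l : Fin k → ℕ) :
    Set ((ℤ → Fin k) × ℕ) :=
  {p | p.1 ∈ SFT A ∧ p.2 < l (p.1 0)}

/-- The tower map `T(x, j) = (x, j+1)` if `j + 1 < l_{x_0}` and `T(x,j) = (σ x, 0)`
if `j + 1 = l_{x_0}`. -/
def towerMap {k : ℕ} (A : Fin k → Fin k → ℕ) (l : Fin k → ℕ) (hl : ∀ i, 0 < l i)
    (p : ↥(towerSet A l)) : ↥(towerSet A l) :=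
  if h : p.1.2 + 1 < l (p.1.1 0) then ⟨(p.1.1, p.1.2 + 1), ⟨p.2.1, h⟩⟩
  else ⟨(shiftMap p.1.1, 0), ⟨fun i => p.2.1 (i + 1), hl _⟩⟩

section Irreducible

theorem matPow_succ_pos_iff {S : Type*} [Fintype S] (A : S → S → ℕ) (m : ℕ) (i j : S) :
    0 < matPow A (m + 1) i j ↔ ∃ r, 0 < matPow A m i r ∧ 0 < A r j := by
  simp [matPow, Finset.sum_pos_iff]

theorem exists_matPow_pos_iff_transGen {S : Type*} [Fintype S] (A : S → S → ℕ) (i j : S) :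
    (∃ m, 1 ≤ m ∧ 0 < matPow A m i j) ↔ Relation.TransGen (fun a b => 0 < A a b) i j := by
  constructor
  · rintro ⟨m, hm, h⟩
    induction m, hm using Nat.le_induction generalizing j with
    | base =>
      obtain ⟨r, hr, hA⟩ := (matPow_succ_pos_iff A 0 i j).1 h
      have : i = r := by
        by_contra hne
        simp [matPow, hne] at hr
      exact .single (this ▸ hA)
    | succ m _ ih =>
      obtain ⟨r, hr, hA⟩ := (matPow_succ_pos_iff A m i j).1 h
      exact (ih r hr).tail hA
  · intro h
    induction h with
    | single h => exact ⟨1, le_rfl, (matPow_succ_pos_iff A 0 _ _).2 ⟨i, by simp [matPow], h⟩⟩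
    | tail _ h ih =>
      obtain ⟨m, _, hp⟩ := ih
      exact ⟨m + 1, by omega, (matPow_succ_pos_iff A m _ _).2 ⟨_, hp, h⟩⟩

end Irreducible

section TowerGraph

variable {k : ℕ} (A : Fin k → Fin k → ℕ) (l : Fin k → ℕ)

/-- The vertices of the tower graph: a letter `i` together with a level below `l i`. -/
abbrev TowerVertex : Type := (i : Fin k) × Fin (l i)

variable {l} in
theorem TowerVertex.ext {a b : TowerVertex l} (h₁ : a.1 = b.1) (h₂ : (a.2 : ℕ) = b.2) :
    a = b := by
  obtain ⟨i, a⟩ := a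
  obtain ⟨j, b⟩ := b
  obtain rfl : i = j := h₁
  exact congrArg _ (Fin.ext h₂)

/-- The edges of the tower graph: climb one level, or go from the top level over a letter to
the bottom level over an `A`-successor. -/
def TowerStep (a b : TowerVertex l) : Prop :=
  (a.1 = b.1 ∧ (a.2 : ℕ) + 1 = b.2) ∨ ((a.2 : ℕ) + 1 = l a.1 ∧ (b.2 : ℕ) = 0 ∧ A a.1 b.1 = 1)

variable {A l}

theorem TowerStep.reflTransGen_climb (i : Fin k) {m n : ℕ} (hmn : m ≤ n) (hn : n < l i) :
    Relation.ReflTransGen (TowerStep A l) ⟨i, m, hmn.trans_lt hn⟩ ⟨i, n, hn⟩ := by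
  induction n, hmn using Nat.le_induction with
  | base => exact .refl
  | succ n _ ih => exact (ih (by omega)).tail (.inl ⟨rfl, rfl⟩)

theorem TowerStep.transGen_of_transGen (h01 : ∀ i j, A i j = 0 ∨ A i j = 1)
    (hl : ∀ i, 0 < l i) {i j : Fin k} (h : Relation.TransGen (fun a b => 0 < A a b) i j) :
    Relation.TransGen (TowerStep A l) ⟨i, l i - 1, Nat.sub_one_lt (hl i).ne'⟩ ⟨j, 0, hl j⟩ := by
  have edge : ∀ i j, 0 < A i j →
      TowerStep A l ⟨i, l i - 1, Nat.sub_one_lt (hl i).ne'⟩ ⟨j, 0, hl j⟩ := fun i j h =>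
    .inr ⟨Nat.sub_add_cancel (hl i), rfl, (h01 i j).resolve_left h.ne'⟩
  induction h with
  | single h => exact .single (edge _ _ h)
  | tail _ h ih =>
    exact (ih.trans_left (reflTransGen_climb _ (Nat.zero_le _) _)).tail (edge _ _ h)

theorem TowerStep.transGen (h01 : ∀ i j, A i j = 0 ∨ A i j = 1) (hirr : IrreducibleMat A)
    (hl : ∀ i, 0 < l i) (a b : TowerVertex l) : Relation.TransGen (TowerStep A l) a b := by
  obtain ⟨i, m, hm⟩ := a
  obtain ⟨j, n, hn⟩ := b
  have h := transGen_of_transGen h01 hl ((exists_matPow_pos_iff_transGen A i j).1 (hirr i j))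
  exact (h.trans_right (reflTransGen_climb i (by omega) _)).trans_left
    (reflTransGen_climb j (Nat.zero_le _) hn)

variable {y : ℤ → TowerVertex l}

theorem TowerStep.climb (hy : ∀ n, TowerStep A l (y n) (y (n + 1))) (t : ℤ) (d : ℕ)
    (hd : ((y t).2 : ℕ) + d < l (y t).1) :
    (y (t + d)).1 = (y t).1 ∧ ((y (t + d)).2 : ℕ) = (y t).2 + d := by
  induction d with
  | zero =>
    rw [Nat.cast_zero, show t + 0 = t from add_zero t]
    exact ⟨rfl, rfl⟩
  | succ d ih =>
    obtain ⟨h₁, h₂⟩ := ih (by omega)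
    have h := hy (t + d)
    rw [show t + ((d + 1 : ℕ) : ℤ) = t + d + 1 by push_cast; ring]
    have hl₁ := congrArg l h₁
    rcases h with ⟨h₃, h₄⟩ | ⟨h₃, -⟩
    · exact ⟨h₃.symm.trans h₁, by omega⟩
    · omega

theorem TowerStep.descend (hy : ∀ n, TowerStep A l (y n) (y (n + 1))) (t : ℤ) (d : ℕ)
    (hd : d ≤ ((y t).2 : ℕ)) :
    (y (t - d)).1 = (y t).1 ∧ ((y (t - d)).2 : ℕ) + d = (y t).2 := by
  induction d with
  | zero =>
    rw [Nat.cast_zero, show t - 0 = t from sub_zero t]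
    exact ⟨rfl, rfl⟩
  | succ d ih =>
    obtain ⟨h₁, h₂⟩ := ih (by omega)
    have h := hy (t - (d + 1 : ℕ))
    rw [show t - ((d + 1 : ℕ) : ℤ) + 1 = t - d by push_cast; ring] at h
    rcases h with ⟨h₃, h₄⟩ | ⟨-, h₃, -⟩
    · exact ⟨h₃.trans h₁, by omega⟩
    · omega

theorem TowerStep.next_bottom (hl : ∀ i, 0 < l i) (hy : ∀ n, TowerStep A l (y n) (y (n + 1)))
    (t : ℤ) (ht : ((y t).2 : ℕ) = 0) :
    (y (t + l (y t).1 - 1)).1 = (y t).1 ∧ ((y (t + l (y t).1)).2 : ℕ) = 0 ∧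
      A (y t).1 (y (t + l (y t).1)).1 = 1 := by
  have hpos := hl (y t).1
  obtain ⟨h₁, h₂⟩ := climb hy t (l (y t).1 - 1) (by omega)
  have h := hy (t + (l (y t).1 - 1 : ℕ))
  rw [show t + ((l (y t).1 - 1 : ℕ) : ℤ) = t + l (y t).1 - 1 by omega] at h h₁ h₂
  rw [show t + (l (y t).1 : ℤ) - 1 + 1 = t + l (y t).1 by ring] at h
  rcases h with ⟨h₃, h₄⟩ | ⟨h₃, h₄, h₅⟩
  · have hlt := (y (t + l (y t).1)).2.isLt
    have hl₁ := congrArg l (h₃.symm.trans h₁)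
    omega
  · exact ⟨h₁, h₄, by rwa [h₁] at h₅⟩

theorem TowerStep.previous_bottom (hl : ∀ i, 0 < l i) (hy : ∀ n, TowerStep A l (y n) (y (n + 1)))
    (t : ℤ) (ht : ((y t).2 : ℕ) = 0) :
    (y (t - l (y (t - 1)).1)).1 = (y (t - 1)).1 ∧ ((y (t - l (y (t - 1)).1)).2 : ℕ) = 0 := by
  have h := hy (t - 1)
  rw [sub_add_cancel] at h
  rcases h with ⟨-, h₂⟩ | ⟨h₁, -⟩
  · omega
  · have hpos := hl (y (t - 1)).1
    have hd := descend hy (t - 1) (l (y (t - 1)).1 - 1) (by omega)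
    rw [show t - 1 - ((l (y (t - 1)).1 - 1 : ℕ) : ℤ) = t - l (y (t - 1)).1 by omega] at hd
    exact ⟨hd.1, by omega⟩

/-- The first-return map on the set of times at which a path sits at the bottom level. -/
def bottomReturn (hl : ∀ i, 0 < l i) (hy : ∀ n, TowerStep A l (y n) (y (n + 1))) :
    Equiv.Perm {t : ℤ // ((y t).2 : ℕ) = 0} where
  toFun t := ⟨t + l (y t).1, (TowerStep.next_bottom hl hy t t.2).2.1⟩
  invFun t := ⟨t - l (y (t - 1)).1, (TowerStep.previous_bottom hl hy t t.2).2⟩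
  left_inv t := Subtype.ext (by
    dsimp only
    rw [(TowerStep.next_bottom hl hy t t.2).1]
    ring)
  right_inv t := Subtype.ext (by
    dsimp only
    rw [(TowerStep.previous_bottom hl hy t t.2).1]
    ring)

end TowerGraph

section Tower

variable {k : ℕ} {A : Fin k → Fin k → ℕ} {l : Fin k → ℕ}

theorem isClosed_SFT {S : Type*} [TopologicalSpace S] [DiscreteTopology S] (A : S → S → ℕ) :
    IsClosed (SFT A) := by
  have : SFT A = ⋂ i : ℤ, (fun x : ℤ → S => (x i, x (i + 1))) ⁻¹' {p | A p.1 p.2 = 1} := by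
    ext x
    simp [SFT]
  rw [this]
  exact isClosed_iInter fun i => (isClosed_discrete _).preimage (by fun_prop)

theorem isCompact_towerSet (A : Fin k → Fin k → ℕ) (l : Fin k → ℕ) :
    IsCompact (towerSet A l) := by
  have hc : IsClosed (towerSet A l) := by
    have : towerSet A l = Prod.fst ⁻¹' SFT A ∩
        (fun p : (ℤ → Fin k) × ℕ => (p.1 0, p.2)) ⁻¹' {q | q.2 < l q.1} := rfl
    rw [this]
    exact ((isClosed_SFT A).preimage continuous_fst).inter
      ((isClosed_discrete _).preimage (by fun_prop))
  refine (isCompact_univ.prod (Set.finite_Iio (∑ i, l i)).isCompact).of_isClosed_subset hc ?_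
  rintro p ⟨-, hp⟩
  exact ⟨Set.mem_univ _, hp.trans_le (Finset.single_le_sum (fun _ _ => Nat.zero_le _)
    (Finset.mem_univ _))⟩

theorem towerMap_of_lt (hl : ∀ i, 0 < l i) (p : towerSet A l)
    (h : p.1.2 + 1 < l (p.1.1 0)) : (towerMap A l hl p).1 = (p.1.1, p.1.2 + 1) := by
  simp [towerMap, h]

theorem towerMap_of_eq (hl : ∀ i, 0 < l i) (p : towerSet A l)
    (h : p.1.2 + 1 = l (p.1.1 0)) : (towerMap A l hl p).1 = (shiftMap p.1.1, 0) := by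
  simp [towerMap, h]

theorem continuous_towerMap (hl : ∀ i, 0 < l i) : Continuous (towerMap A l hl) := by
  have hclopen : IsClopen {p : towerSet A l | p.1.2 + 1 < l (p.1.1 0)} :=
    (isClopen_discrete {q : Fin k × ℕ | q.2 + 1 < l q.1}).preimage
      (f := fun p : towerSet A l => (p.1.1 0, p.1.2)) (by fun_prop)
  have heq : ∀ p : towerSet A l, (towerMap A l hl p).1 =
      if p.1.2 + 1 < l (p.1.1 0) then (p.1.1, p.1.2 + 1) else (shiftMap p.1.1, 0) := by
    intro p
    unfold towerMap
    split_ifs <;> rfl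
  refine continuous_induced_rng.2 ?_
  refine Continuous.congr ?_ fun p => (heq p).symm
  refine Continuous.if (by simp [hclopen.frontier_eq]) (by fun_prop) ?_
  unfold shiftMap
  fun_prop

/-- The inverse of the tower map. -/
def towerMapInv (A : Fin k → Fin k → ℕ) (l : Fin k → ℕ) (hl : ∀ i, 0 < l i)
    (p : towerSet A l) : towerSet A l :=
  if p.1.2 = 0 then
    ⟨(fun i => p.1.1 (i - 1), l (p.1.1 (0 - 1)) - 1),
      fun i => by simpa [add_sub_right_comm] using p.2.1 (i - 1), Nat.sub_one_lt (hl _).ne'⟩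
  else ⟨(p.1.1, p.1.2 - 1), p.2.1, (Nat.sub_le _ _).trans_lt p.2.2⟩

theorem towerMapInv_of_eq_zero (hl : ∀ i, 0 < l i) (p : towerSet A l) (h : p.1.2 = 0) :
    (towerMapInv A l hl p).1 = (fun i => p.1.1 (i - 1), l (p.1.1 (0 - 1)) - 1) := by
  simp [towerMapInv, h]

theorem towerMapInv_of_ne_zero (hl : ∀ i, 0 < l i) (p : towerSet A l) (h : p.1.2 ≠ 0) :
    (towerMapInv A l hl p).1 = (p.1.1, p.1.2 - 1) := by
  simp [towerMapInv, h]

/-- The tower map as a permutation of the tower. -/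
def towerPerm (A : Fin k → Fin k → ℕ) (l : Fin k → ℕ) (hl : ∀ i, 0 < l i) :
    Equiv.Perm (towerSet A l) where
  toFun := towerMap A l hl
  invFun := towerMapInv A l hl
  left_inv p := Subtype.ext (by
    rcases (Nat.succ_le_of_lt p.2.2).lt_or_eq with h | h
    · have hT := towerMap_of_lt hl p h
      rw [towerMapInv_of_ne_zero hl _ (by simp [hT]), hT]
      simp
    · have hT := towerMap_of_eq hl p h
      rw [towerMapInv_of_eq_zero hl _ (by simp [hT]), hT]
      ext1
      · simp [shiftMap]
      · simp [shiftMap, ← h])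
  right_inv p := Subtype.ext (by
    by_cases h : p.1.2 = 0
    · have hT := towerMapInv_of_eq_zero hl p h
      rw [towerMap_of_eq hl _ (by rw [hT]; exact Nat.sub_add_cancel (hl _)), hT]
      ext1
      · funext i
        simp [shiftMap]
      · exact h.symm
    · have hT := towerMapInv_of_ne_zero hl p h
      have hp := p.2.2
      rw [towerMap_of_lt hl _ (by rw [hT]; dsimp only; omega), hT]
      ext1
      · rfl
      · dsimp only
        omega)

theorem continuous_towerPerm_zpow (hl : ∀ i, 0 < l i) (n : ℤ) :
    Continuous ⇑(towerPerm A l hl ^ n) := by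
  have : CompactSpace (towerSet A l) := isCompact_iff_compactSpace.1 (isCompact_towerSet A l)
  have hT : Continuous ⇑(towerPerm A l hl) := continuous_towerMap hl
  have hT' : Continuous ⇑(towerPerm A l hl)⁻¹ := hT.continuous_symm_of_equiv_compact_to_t2
  induction n with
  | zero => simpa using continuous_id
  | succ n ih =>
    rw [zpow_add_one]
    exact ih.comp hT
  | pred n ih =>
    rw [zpow_sub_one]
    exact ih.comp hT'

/-- The vertex of the tower graph occupied by a point of the tower. -/
def towerVertex (p : towerSet A l) : TowerVertex l := ⟨p.1.1 0, p.1.2, p.2.2⟩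

theorem continuous_towerVertex : Continuous (towerVertex : towerSet A l → TowerVertex l) := by
  refine continuous_discrete_rng.2 fun v => ?_
  have : towerVertex ⁻¹' {v} =
      (fun p : towerSet A l => (p.1.1 0, p.1.2)) ⁻¹' {(v.1, (v.2 : ℕ))} := by
    ext p
    simp only [Set.mem_preimage, Set.mem_singleton_iff, Prod.mk.injEq]
    exact ⟨fun h => h ▸ ⟨rfl, rfl⟩, fun h => TowerVertex.ext h.1 h.2⟩
  rw [this]
  exact (isOpen_discrete _).preimage (by fun_prop)

theorem towerStep_towerVertex (hl : ∀ i, 0 < l i) (p : towerSet A l) :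
    TowerStep A l (towerVertex p) (towerVertex (towerMap A l hl p)) := by
  rcases (Nat.succ_le_of_lt p.2.2).lt_or_eq with h | h
  · have hT := towerMap_of_lt hl p h
    exact .inl ⟨by simp [towerVertex, hT], by simp [towerVertex, hT]⟩
  · have hT := towerMap_of_eq hl p h
    exact .inr ⟨h, by simp [towerVertex, hT],
      by simpa [towerVertex, hT, shiftMap] using p.2.1 0⟩

/-- The itinerary of a point of the tower through the tower graph. -/
def towerItinerary (hl : ∀ i, 0 < l i) (p : towerSet A l) (n : ℤ) : TowerVertex l :=
  towerVertex ((towerPerm A l hl ^ n) p)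

theorem continuous_towerItinerary (hl : ∀ i, 0 < l i) :
    Continuous (towerItinerary hl : towerSet A l → ℤ → TowerVertex l) :=
  continuous_pi fun n => continuous_towerVertex.comp (continuous_towerPerm_zpow hl n)

theorem towerItinerary_zpow (hl : ∀ i, 0 < l i) (p : towerSet A l) (m n : ℤ) :
    towerItinerary hl ((towerPerm A l hl ^ m) p) n = towerItinerary hl p (n + m) := by
  rw [towerItinerary, towerItinerary, zpow_add]
  rfl

theorem towerItinerary_towerMap (hl : ∀ i, 0 < l i) (p : towerSet A l) (n : ℤ) :
    towerItinerary hl (towerMap A l hl p) n = towerItinerary hl p (n + 1) := by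
  rw [← towerItinerary_zpow, zpow_one]
  rfl

theorem towerItinerary_towerMapInv (hl : ∀ i, 0 < l i) (p : towerSet A l) (n : ℤ) :
    towerItinerary hl (towerMapInv A l hl p) n = towerItinerary hl p (n - 1) := by
  rw [sub_eq_add_neg, ← towerItinerary_zpow, zpow_neg_one]
  rfl

theorem towerStep_towerItinerary (hl : ∀ i, 0 < l i) (p : towerSet A l) (n : ℤ) :
    TowerStep A l (towerItinerary hl p n) (towerItinerary hl p (n + 1)) := by
  rw [add_comm n 1, towerItinerary, towerItinerary, zpow_one_add]
  exact towerStep_towerVertex hl _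

theorem zero_eq_of_towerItinerary_eq (hl : ∀ i, 0 < l i) {p q : towerSet A l}
    (h : towerItinerary hl p = towerItinerary hl q) :
    p.1.1 0 = q.1.1 0 ∧ p.1.2 = q.1.2 := by
  have h0 : towerVertex p = towerVertex q := congrFun h 0
  exact ⟨congrArg Sigma.fst h0, congrArg (fun v : TowerVertex l => (v.2 : ℕ)) h0⟩

theorem natCast_eq_of_towerItinerary_eq (hl : ∀ i, 0 < l i) (m : ℕ) {p q : towerSet A l}
    (h : towerItinerary hl p = towerItinerary hl q) : p.1.1 m = q.1.1 m := by
  induction m generalizing p q with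
  | zero => exact (zero_eq_of_towerItinerary_eq hl h).1
  | succ m ih =>
    induction hd : l (p.1.1 0) - p.1.2 generalizing p q with
    | zero => exact absurd p.2.2 (by omega)
    | succ d ihd =>
      obtain ⟨h₁, h₂⟩ := zero_eq_of_towerItinerary_eq hl h
      have hT : towerItinerary hl (towerMap A l hl p) = towerItinerary hl (towerMap A l hl q) := by
        funext n
        rw [towerItinerary_towerMap, towerItinerary_towerMap, h]
      rcases (Nat.succ_le_of_lt p.2.2).lt_or_eq with hp | hp
      · have hpT := towerMap_of_lt hl p hp
        have hqT := towerMap_of_lt hl q (by rwa [← h₁, ← h₂])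
        have := ihd hT (by rw [hpT]; dsimp only; omega)
        rwa [hpT, hqT] at this
      · have hpT := towerMap_of_eq hl p hp
        have hqT := towerMap_of_eq hl q (by rwa [← h₁, ← h₂])
        have := ih hT
        rw [hpT, hqT] at this
        simpa [shiftMap] using this

theorem neg_natCast_eq_of_towerItinerary_eq (hl : ∀ i, 0 < l i) (m : ℕ) {p q : towerSet A l}
    (h : towerItinerary hl p = towerItinerary hl q) : p.1.1 (-m) = q.1.1 (-m) := by
  induction m generalizing p q with
  | zero => exact (zero_eq_of_towerItinerary_eq hl h).1
  | succ m ih =>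
    induction hd : p.1.2 generalizing p q with
    | zero =>
      have h₂ := (zero_eq_of_towerItinerary_eq hl h).2
      have hT : towerItinerary hl (towerMapInv A l hl p) =
          towerItinerary hl (towerMapInv A l hl q) := by
        funext n
        rw [towerItinerary_towerMapInv, towerItinerary_towerMapInv, h]
      have := ih hT
      rw [towerMapInv_of_eq_zero hl p hd, towerMapInv_of_eq_zero hl q (h₂ ▸ hd)] at this
      rw [show -((m + 1 : ℕ) : ℤ) = -m - 1 by push_cast; ring]
      exact this
    | succ d ihd =>
      have h₂ := (zero_eq_of_towerItinerary_eq hl h).2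
      have hT : towerItinerary hl (towerMapInv A l hl p) =
          towerItinerary hl (towerMapInv A l hl q) := by
        funext n
        rw [towerItinerary_towerMapInv, towerItinerary_towerMapInv, h]
      have hpT := towerMapInv_of_ne_zero hl p (by omega)
      have := ihd hT (by rw [hpT]; dsimp only; omega)
      rwa [hpT, towerMapInv_of_ne_zero hl q (by omega)] at this

theorem towerItinerary_injective (hl : ∀ i, 0 < l i) :
    Function.Injective (towerItinerary hl : towerSet A l → ℤ → TowerVertex l) := by
  intro p q h
  refine Subtype.ext (Prod.ext (funext fun n => ?_) (zero_eq_of_towerItinerary_eq hl h).2)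
  obtain ⟨m, rfl | rfl⟩ := n.eq_nat_or_neg
  · exact natCast_eq_of_towerItinerary_eq hl m h
  · exact neg_natCast_eq_of_towerItinerary_eq hl m h

/-- The path `y` sits at the bottom level over the letters of `p` at the times `s n`, spaced by
the heights of these letters, where `s 0` is the last such time up to the present. -/
def IsTowerCoding (p : towerSet A l) (y : ℤ → TowerVertex l) : Prop :=
  ∃ s : ℤ → ℤ, s 0 = -p.1.2 ∧ (∀ n, s (n + 1) = s n + l (p.1.1 n)) ∧
    ∀ n, (y (s n)).1 = p.1.1 n ∧ ((y (s n)).2 : ℕ) = 0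

theorem IsTowerCoding.towerVertex_eq {p : towerSet A l} {y : ℤ → TowerVertex l}
    (hy : ∀ n, TowerStep A l (y n) (y (n + 1))) (h : IsTowerCoding p y) :
    towerVertex p = y 0 := by
  obtain ⟨s, h0, -, hs⟩ := h
  obtain ⟨h₁, h₂⟩ := hs 0
  have hp := p.2.2
  have hl₁ := congrArg l h₁
  obtain ⟨h₃, h₄⟩ := TowerStep.climb hy (s 0) p.1.2 (by omega)
  rw [show s 0 + (p.1.2 : ℤ) = 0 by omega] at h₃ h₄
  exact TowerVertex.ext (h₃.trans h₁).symm (by rw [h₄, h₂, zero_add]; rfl)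

theorem IsTowerCoding.map (hl : ∀ i, 0 < l i) {p : towerSet A l} {y : ℤ → TowerVertex l}
    (h : IsTowerCoding p y) : IsTowerCoding (towerMap A l hl p) (fun n => y (n + 1)) := by
  obtain ⟨s, h0, h1, hs⟩ := h
  rcases (Nat.succ_le_of_lt p.2.2).lt_or_eq with hp | hp
  · rw [IsTowerCoding, towerMap_of_lt hl p hp]
    refine ⟨fun n => s n - 1, ?_, fun n => ?_, fun n => ?_⟩
    · simp only [h0]; push_cast; ring
    · simp only [h1]; ring
    · dsimp only
      rw [sub_add_cancel]
      exact hs n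
  · rw [IsTowerCoding, towerMap_of_eq hl p hp]
    refine ⟨fun n => s (n + 1) - 1, ?_, fun n => ?_, fun n => ?_⟩
    · simp only [h1, h0, ← hp]; push_cast; ring
    · simp only [h1 (n + 1), shiftMap]; ring
    · dsimp only
      rw [sub_add_cancel]
      exact hs (n + 1)

theorem IsTowerCoding.mapInv (hl : ∀ i, 0 < l i) {p : towerSet A l} {y : ℤ → TowerVertex l}
    (h : IsTowerCoding p y) : IsTowerCoding (towerMapInv A l hl p) (fun n => y (n - 1)) := by
  obtain ⟨s, h0, h1, hs⟩ := h
  by_cases hp : p.1.2 = 0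
  · rw [IsTowerCoding, towerMapInv_of_eq_zero hl p hp]
    refine ⟨fun n => s (n - 1) + 1, ?_, fun n => ?_, fun n => ?_⟩
    · have := h1 (0 - 1)
      have hpos := hl (p.1.1 (0 - 1))
      rw [sub_add_cancel, h0] at this
      dsimp only
      omega
    · have := h1 (n - 1)
      rw [sub_add_cancel] at this
      simp only [add_sub_cancel_right, this]; ring
    · dsimp only
      rw [add_sub_cancel_right]
      exact hs (n - 1)
  · rw [IsTowerCoding, towerMapInv_of_ne_zero hl p hp]
    refine ⟨fun n => s n + 1, ?_, fun n => ?_, fun n => ?_⟩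
    · dsimp only
      omega
    · simp only [h1]; ring
    · dsimp only
      rw [add_sub_cancel_right]
      exact hs n

theorem IsTowerCoding.zpow (hl : ∀ i, 0 < l i) {p : towerSet A l} {y : ℤ → TowerVertex l}
    (h : IsTowerCoding p y) (m : ℤ) :
    IsTowerCoding ((towerPerm A l hl ^ m) p) (fun n => y (n + m)) := by
  induction m with
  | zero => simpa using h
  | succ m ih =>
    have hfun : (fun n => y (n + (m + 1))) = fun n => y (n + 1 + m) :=
      funext fun n => congrArg y (by ring)
    rw [hfun, add_comm (m : ℤ) 1, zpow_one_add]
    exact ih.map hl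
  | pred m ih =>
    have hfun : (fun n => y (n + (-m - 1))) = fun n => y (n - 1 + -m) :=
      funext fun n => congrArg y (by ring)
    rw [hfun, ← neg_add_eq_sub, zpow_add, zpow_neg_one]
    exact ih.mapInv hl

theorem exists_isTowerCoding (hl : ∀ i, 0 < l i) {y : ℤ → TowerVertex l}
    (hy : ∀ n, TowerStep A l (y n) (y (n + 1))) : ∃ p : towerSet A l, IsTowerCoding p y := by
  obtain ⟨h₁, h₂⟩ := TowerStep.descend hy 0 (y 0).2 le_rfl
  rw [zero_sub] at h₁ h₂
  let R := bottomReturn hl hy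
  let t₀ : {t : ℤ // ((y t).2 : ℕ) = 0} := ⟨-((y 0).2 : ℕ), by omega⟩
  have hR : ∀ n : ℤ, (((R ^ (n + 1)) t₀ : {t : ℤ // ((y t).2 : ℕ) = 0}) : ℤ) =
      (R ^ n) t₀ + l (y ((R ^ n) t₀)).1 := by
    intro n
    rw [add_comm n 1, zpow_one_add]
    rfl
  refine ⟨⟨(fun n => (y ((R ^ n) t₀)).1, (y 0).2), fun n => ?_, ?_⟩, fun n => (R ^ n) t₀,
    rfl, hR, fun n => ⟨rfl, ((R ^ n) t₀).2⟩⟩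
  · dsimp only
    rw [hR]
    exact (TowerStep.next_bottom hl hy _ ((R ^ n) t₀).2).2.2
  · change ((y 0).2 : ℕ) < l (y (-((y 0).2 : ℕ))).1
    rw [h₁]
    exact (y 0).2.isLt

theorem exists_towerItinerary_eq (hl : ∀ i, 0 < l i) {y : ℤ → TowerVertex l}
    (hy : ∀ n, TowerStep A l (y n) (y (n + 1))) :
    ∃ p : towerSet A l, towerItinerary hl p = y := by
  obtain ⟨p, hp⟩ := exists_isTowerCoding hl hy
  refine ⟨p, funext fun m => ?_⟩
  have := (hp.zpow hl m).towerVertex_eq fun n => by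
    simpa only [add_right_comm] using hy (n + m)
  rwa [zero_add] at this

end Tower

/-- Let `A` be an irreducible `k × k` 0-1 matrix, `l_0, …, l_{k-1}`
positive integers, `L = l_0 + ⋯ + l_{k-1}`, and let `(X, T)` be the discrete tower
over `(Σ_A, σ)` with height function `x ↦ l_{x_0}`. Then there is an irreducible
`L × L` 0-1 matrix `B` such that `(Σ_B, σ)` is topologically conjugate to `(X, T)`:
there is a homeomorphism `g : Σ_B → X` with `g ∘ σ = T ∘ g`. -/
theorem stmt10 {k : ℕ} (A : Fin k → Fin k → ℕ)
    (h01 : ∀ i j, A i j = 0 ∨ A i j = 1) (hirr : IrreducibleMat A)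
    (l : Fin k → ℕ) (hl : ∀ i, 0 < l i) :
    ∃ B : Fin (∑ i, l i) → Fin (∑ i, l i) → ℕ,
      (∀ i j, B i j = 0 ∨ B i j = 1) ∧ IrreducibleMat B ∧
      ∃ g : ↥(SFT B) ≃ₜ ↥(towerSet A l),
        ∀ y : ↥(SFT B), g (restrictShift B y) = towerMap A l hl (g y) := by
  classical
  let e : TowerVertex l ≃ Fin (∑ i, l i) := finSigmaFinEquiv
  let B : Fin (∑ i, l i) → Fin (∑ i, l i) → ℕ := fun a b =>
    if TowerStep A l (e.symm a) (e.symm b) then 1 else 0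
  have hB : ∀ a b, B a b = 1 ↔ TowerStep A l (e.symm a) (e.symm b) := by simp [B]
  refine ⟨B, fun a b => ?_, fun a b => ?_, ?_⟩
  · by_cases h : TowerStep A l (e.symm a) (e.symm b) <;> simp [B, h]
  · rw [exists_matPow_pos_iff_transGen]
    have h := TowerStep.transGen h01 hirr hl (e.symm a) (e.symm b)
    have h' := h.lift (p := fun a b => 0 < B a b) e fun u v huv => by
      simp [Function.onFun, B, huv]
    rwa [Function.onFun, e.apply_symm_apply, e.apply_symm_apply] at h'
  · have : CompactSpace (towerSet A l) := isCompact_iff_compactSpace.1 (isCompact_towerSet A l)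
    let f : towerSet A l → SFT B := fun p =>
      ⟨fun n => e (towerItinerary hl p n), fun n => by
        simpa [hB] using towerStep_towerItinerary hl p n⟩
    have hf : Continuous f := continuous_induced_rng.2 <| continuous_pi fun n =>
      continuous_of_discreteTopology.comp
        ((continuous_apply n).comp (continuous_towerItinerary hl))
    have hbij : Function.Bijective f := by
      refine ⟨fun p q h => towerItinerary_injective hl (funext fun n => ?_), fun y => ?_⟩
      · exact e.injective (congrFun (congrArg Subtype.val h) n)
      · obtain ⟨p, hp⟩ := exists_towerItinerary_eq (A := A) hl
          (y := fun n => e.symm (y.1 n)) fun n => (hB _ _).1 (y.2 n)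
        exact ⟨p, Subtype.ext (funext fun n => by simp [f, hp])⟩
    let F : towerSet A l ≃ₜ SFT B :=
      Continuous.homeoOfEquivCompactToT2 (f := Equiv.ofBijective f hbij) hf
    have hF : ∀ p, F (towerMap A l hl p) = restrictShift B (F p) := fun p =>
      Subtype.ext (funext fun n => congrArg e (towerItinerary_towerMap hl p n))
    refine ⟨F.symm, fun y => ?_⟩
    rw [F.symm_apply_eq, hF, F.apply_symm_apply]
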